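/- arXiv:math/9907106 — 2 statements merged into one kernel-verified Lean document; each statement's English description precedes it below -/
import Mathlib

section
/- Let D = (G,F,n) be a datum over an algebraically closed field k of characteristic 0 and H(D) the associated Hopf algebra. Then the first term of the coradical filtration of H(D) is H(D)₁ = k[G] ⊕ (k[G]𝓑), and for all a,b ∈ G the space of a:b skew primitives is P_{a,b}(H(D)) = sp_k{a−b} ⊕ aV_{a⁻¹b}, where V_{a⁻¹b} = 0 if a⁻¹b ∉ I_F. -/
open TensorProduct

noncomputable section

universe u v w

namespace Paper

variable (k : Type*) [Field k]

section Basic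

variable (A : Type*) [Ring A] [HopfAlgebra k A]

/-- `g` is a grouplike element of the Hopf algebra `A`. -/
def IsGrouplike (g : A) : Prop :=
  Coalgebra.counit (R := k) g = 1 ∧ Coalgebra.comul (R := k) g = g ⊗ₜ[k] g

/-- `x` is a `g:h` skew primitive element of `A`, i.e. `Δ(x) = x ⊗ g + h ⊗ x`. -/
def IsSkewPrimitive (g h x : A) : Prop :=
  Coalgebra.comul (R := k) x = x ⊗ₜ[k] g + h ⊗ₜ[k] x

/-- The space `P_{g,h}(A)` of `g:h` skew primitives, as a submodule. -/
def skewPrimitives (g h : A) : Submodule k A :=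
  LinearMap.ker (Coalgebra.comul (R := k) -
    ((TensorProduct.mk k A A).flip g + TensorProduct.mk k A A h))

end Basic

section Coalg

variable {M : Type*} [AddCommGroup M] [Module k M]

/-- `C` is a subcoalgebra with respect to the comultiplication `d`. -/
def IsSubcoalgebraOf (d : M →ₗ[k] M ⊗[k] M) (C : Submodule k M) : Prop :=
  ∀ x ∈ C, d x ∈ LinearMap.range (TensorProduct.map C.subtype C.subtype)

/-- `C` is a simple subcoalgebra with respect to `d`. -/
def IsSimpleSubcoalgebraOf (d : M →ₗ[k] M ⊗[k] M) (C : Submodule k M) : Prop :=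
  C ≠ ⊥ ∧ IsSubcoalgebraOf k d C ∧
    ∀ D : Submodule k M, IsSubcoalgebraOf k d D → D ≤ C → D = ⊥ ∨ D = C

/-- A coalgebra is pointed if all its simple subcoalgebras are `1`-dimensional. -/
def IsPointedOf (d : M →ₗ[k] M ⊗[k] M) : Prop :=
  ∀ C : Submodule k M, IsSimpleSubcoalgebraOf k d C → Module.finrank k C = 1

/-- The coradical: the sum of all simple subcoalgebras. -/
def coradicalOf (d : M →ₗ[k] M ⊗[k] M) : Submodule k M :=
  sSup {C | IsSimpleSubcoalgebraOf k d C}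

/-- The first term `A₁ = Δ⁻¹(A₀ ⊗ A + A ⊗ A₀)` of the coradical filtration. -/
def firstCoradicalTermOf (d : M →ₗ[k] M ⊗[k] M) : Submodule k M :=
  Submodule.comap d
    (LinearMap.range (TensorProduct.map (coradicalOf k d).subtype (LinearMap.id (M := M))) ⊔
      LinearMap.range (TensorProduct.map (LinearMap.id (M := M)) (coradicalOf k d).subtype))

end Coalg

section Hopf

variable (A : Type*) [Ring A] [HopfAlgebra k A]

/-- A Hopf algebra is pointed if all its simple subcoalgebras are `1`-dimensional. -/
def IsPointed : Prop := IsPointedOf k (Coalgebra.comul (R := k) (A := A))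

/-- A subalgebra `B` of `A` is a sub-Hopf-algebra if it is closed under
comultiplication and under the antipode. -/
def IsSubHopf (B : Subalgebra k A) : Prop :=
  (∀ x ∈ B, Coalgebra.comul (R := k) x ∈
      LinearMap.range (TensorProduct.map B.toSubmodule.subtype B.toSubmodule.subtype)) ∧
  ∀ x ∈ B, HopfAlgebra.antipode (R := k) x ∈ B

/-- `r` belongs to `K ⊗ K ⊆ A ⊗ A` for a submodule `K` of `A`. -/
def MemTensorSquare (K : Submodule k A) (r : A ⊗[k] A) : Prop :=
  r ∈ LinearMap.range (TensorProduct.map K.subtype K.subtype)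

/-- `(Δ ⊗ id)(r) = r₁₃ r₂₃`. -/
def Hexagon₁ (r : A ⊗[k] A) : Prop :=
  Algebra.TensorProduct.map (Bialgebra.comulAlgHom k A) (AlgHom.id k A) r =
    Algebra.TensorProduct.map (Algebra.TensorProduct.includeLeft (R := k) (S := k)) (AlgHom.id k A) r *
      Algebra.TensorProduct.map (Algebra.TensorProduct.includeRight (R := k)) (AlgHom.id k A) r

/-- `(id ⊗ Δ)(r) = r₁₃ r₁₂`. -/
def Hexagon₂ (r : A ⊗[k] A) : Prop :=
  Algebra.TensorProduct.map (AlgHom.id k A) (Bialgebra.comulAlgHom k A) r =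
    Algebra.TensorProduct.map (AlgHom.id k A) (Algebra.TensorProduct.includeRight (R := k)) r *
      Algebra.TensorProduct.map (AlgHom.id k A) (Algebra.TensorProduct.includeLeft (R := k) (S := k)) r

/-- The Drinfeld element `u = Σ S(R⁽²⁾) R⁽¹⁾` associated to an element `r ∈ A ⊗ A`. -/
def drinfeldOf (r : A ⊗[k] A) : A :=
  LinearMap.mul' k A
    ((TensorProduct.map (HopfAlgebra.antipode (R := k)) LinearMap.id)
      ((TensorProduct.comm k A A) r))

/-- A quasitriangular structure on the Hopf algebra `A`. -/
structure QuasiTriangular where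
  /-- the R-matrix -/
  R : A ⊗[k] A
  isUnit : IsUnit R
  intertwine : ∀ a : A,
    (TensorProduct.comm k A A) (Coalgebra.comul (R := k) a) * R = R * Coalgebra.comul (R := k) a
  hexagon₁ : Hexagon₁ k A R
  hexagon₂ : Hexagon₂ k A R

variable {A}

/-- A quasitriangular Hopf algebra is triangular if `R R₂₁ = 1 ⊗ 1`. -/
def QuasiTriangular.IsTriangular (Q : QuasiTriangular k A) : Prop :=
  Q.R * (TensorProduct.comm k A A) Q.R = 1

/-- `(A,R)` is minimal if no proper sub-Hopf-algebra contains the components of `R`. -/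
def QuasiTriangular.IsMinimal (Q : QuasiTriangular k A) : Prop :=
  ∀ B : Subalgebra k A, IsSubHopf k A B → MemTensorSquare k A B.toSubmodule Q.R → B = ⊤

/-- The Drinfeld element of a quasitriangular Hopf algebra. -/
def QuasiTriangular.drinfeld (Q : QuasiTriangular k A) : A := drinfeldOf k A Q.R

/-- The map `f_R : A* → A`, `p ↦ (p ⊗ I)(R)`. -/
def fR (Q : QuasiTriangular k A) : Module.Dual k A →ₗ[k] A :=
  TensorProduct.lift
    (LinearMap.mk₂ k (fun a b => (Module.Dual.eval k A a).smulRight b)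
      (fun a a' b => by ext p; simp [add_smul])
      (fun c a b => by ext p; simp [smul_smul])
      (fun a b b' => by ext p; simp [smul_add])
      (fun c a b => by ext p; simp [smul_comm (p a) c b])) Q.R

/-- Radford's coinvariants `B = {x ∈ A | (I ⊗ π)Δ(x) = x ⊗ 1}` of a projection `π`. -/
def coinvariants (π : A →ₗ[k] A) : Submodule k A :=
  LinearMap.ker
    ((TensorProduct.map LinearMap.id π) ∘ₗ Coalgebra.comul (R := k) -
      (TensorProduct.mk k A A).flip 1)

end Hopf


/-- `F` is a non-degenerate skew-symmetric bilinear form on the abelian group `G`,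
with values in `kˣ`: it is multiplicative in each variable, normalized, skew-symmetric,
and the associated map `g ↦ F(g,·)` is an isomorphism onto the character group of `G`. -/
structure IsNondegSkewForm (G : Type w) [CommGroup G] (F : G → G → kˣ) : Prop where
  mul_left : ∀ x y z : G, F (x * y) z = F x z * F y z
  mul_right : ∀ x y z : G, F x (y * z) = F x y * F x z
  one_left : ∀ x : G, F 1 x = 1
  one_right : ∀ x : G, F x 1 = 1
  skew : ∀ x y : G, F x y = (F y x)⁻¹
  nondeg : ∀ χ : G →* kˣ, ∃! g : G, ∀ h : G, F g h = χ h

section Datum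

variable (G : Type w) [CommGroup G] (F : G → G → kˣ) (n : G → ℕ)
  (H : Type v) [Ring H] [HopfAlgebra k H]

/-- A realization of the Hopf algebra `H(D)` associated to the datum `D = (G,F,n)`:
`H` is generated as an algebra by the grouplike elements `ι(a)`, `a ∈ G`, and the `1:g`
skew primitive elements `ψ_g(v)`, `v ∈ V_g` (where `V_g` has dimension `n g` and is
present only for `g ∈ I_F`, i.e. `F g g = -1`), subject exactly to the relations of the
group `G` and the relations `xy = F(h,g) yx`, `xa = F(a,g) ax` of the paper; the field
`free` states the universal property of this presentation, which characterizes `H(D)`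
uniquely up to isomorphism. -/
structure HDPresentation where
  ι : G →* H
  ψ : ∀ g : G, (Fin (n g) → k) →ₗ[k] H
  ι_grouplike : ∀ a : G, IsGrouplike k H (ι a)
  ψ_skewPrimitive : ∀ (g : G) (v : Fin (n g) → k), IsSkewPrimitive k H 1 (ι g) (ψ g v)
  ψ_eq_zero : ∀ g : G, F g g ≠ -1 → ψ g = 0
  comm_ψψ : ∀ g h : G, F g g = -1 → F h h = -1 →
    ∀ (v : Fin (n g) → k) (w : Fin (n h) → k),
      ψ g v * ψ h w = (F h g : k) • (ψ h w * ψ g v)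
  comm_ψι : ∀ g a : G, F g g = -1 → ∀ v : Fin (n g) → k,
    ψ g v * ι a = (F a g : k) • ((ι a : H) * ψ g v)
  generates : Algebra.adjoin k (Set.range ⇑ι ∪ ⋃ g : G, Set.range ⇑(ψ g)) = ⊤
  free : ∀ (C : Type v) [Ring C] [Algebra k C] (j : G →* C)
      (ζ : ∀ g : G, (Fin (n g) → k) →ₗ[k] C),
      (∀ g : G, F g g ≠ -1 → ζ g = 0) →
      (∀ g h : G, F g g = -1 → F h h = -1 →
        ∀ (v : Fin (n g) → k) (w : Fin (n h) → k),
          ζ g v * ζ h w = (F h g : k) • (ζ h w * ζ g v)) →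
      (∀ g a : G, F g g = -1 → ∀ v : Fin (n g) → k,
        ζ g v * j a = (F a g : k) • (j a * ζ g v)) →
      ∃! θ : H →ₐ[k] C, (∀ a : G, θ (ι a) = j a) ∧
        ∀ (g : G) (v : Fin (n g) → k), θ (ψ g v) = ζ g v

end Datum

section Presentation

variable {k}
variable {G : Type w} [CommGroup G] {F : G → G → kˣ} {n : G → ℕ}
  {H : Type v} [Ring H] [HopfAlgebra k H] (D : HDPresentation k G F n H)

namespace HDPresentation

/-- The span `k[G]` of the grouplike generators. -/
def groupSpan : Submodule k H := Submodule.span k (Set.range ⇑D.ι)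

/-- The span `k[G]𝓑` of the products of a grouplike and a skew primitive generator. -/
def skewSpan : Submodule k H :=
  Submodule.span k {x : H | ∃ (a g : G) (v : Fin (n g) → k), x = D.ι a * D.ψ g v}

lemma ι_mem_groupSpan (a : G) : D.ι a ∈ D.groupSpan := Submodule.subset_span ⟨a, rfl⟩

lemma ι_mul_ψ_mem_skewSpan (a g : G) (v : Fin (n g) → k) : D.ι a * D.ψ g v ∈ D.skewSpan :=
  Submodule.subset_span ⟨a, g, v, rfl⟩

lemma comul_ι (a : G) : Coalgebra.comul (R := k) (D.ι a) = D.ι a ⊗ₜ[k] D.ι a :=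
  (D.ι_grouplike a).2

lemma counit_ι (a : G) : Coalgebra.counit (R := k) (D.ι a) = 1 := (D.ι_grouplike a).1

lemma comul_ψ (g : G) (v : Fin (n g) → k) :
    Coalgebra.comul (R := k) (D.ψ g v) = D.ψ g v ⊗ₜ[k] 1 + D.ι g ⊗ₜ[k] D.ψ g v :=
  D.ψ_skewPrimitive g v

lemma ι_ne_zero (a : G) : D.ι a ≠ 0 := fun h => by
  simpa [h] using D.counit_ι a

lemma ι_mul_ι_inv (a : G) : D.ι a * D.ι a⁻¹ = 1 := by rw [← map_mul, mul_inv_cancel, map_one]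

lemma ψ_mul_ι (g a : G) (v : Fin (n g) → k) :
    D.ψ g v * D.ι a = (F a g : k) • (D.ι a * D.ψ g v) := by
  by_cases hg : F g g = -1
  · exact D.comm_ψι g a hg v
  · simp [D.ψ_eq_zero g hg]

lemma ψ_mul_ψ (g h : G) (v : Fin (n g) → k) (w : Fin (n h) → k) :
    D.ψ g v * D.ψ h w = (F h g : k) • (D.ψ h w * D.ψ g v) := by
  by_cases hg : F g g = -1
  · by_cases hh : F h h = -1
    · exact D.comm_ψψ g h hg hh v w
    · simp [D.ψ_eq_zero h hh]
  · simp [D.ψ_eq_zero g hg]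

lemma counit_ψ (g : G) (v : Fin (n g) → k) : Coalgebra.counit (R := k) (D.ψ g v) = 0 := by
  have h := Coalgebra.rTensor_counit_comul (R := k) (D.ψ g v)
  rw [D.comul_ψ, map_add, LinearMap.rTensor_tmul, LinearMap.rTensor_tmul, D.counit_ι,
    add_eq_right] at h
  simpa using congrArg (fun t => LinearMap.mul' k k (Coalgebra.counit.lTensor k t)) h

lemma antipode_ι (a : G) : HopfAlgebra.antipode k (D.ι a) = D.ι a⁻¹ := by
  have h := HopfAlgebra.mul_antipode_rTensor_comul_apply (R := k) (D.ι a)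
  rw [D.comul_ι, D.counit_ι, LinearMap.rTensor_tmul, LinearMap.mul'_apply, map_one] at h
  rw [← mul_one (HopfAlgebra.antipode k _), ← D.ι_mul_ι_inv a, ← mul_assoc, h, one_mul]

lemma antipode_ψ (g : G) (v : Fin (n g) → k) :
    HopfAlgebra.antipode k (D.ψ g v) = -(D.ι g⁻¹ * D.ψ g v) := by
  have h := HopfAlgebra.mul_antipode_rTensor_comul_apply (R := k) (D.ψ g v)
  rw [D.comul_ψ, D.counit_ψ, map_add, LinearMap.rTensor_tmul, LinearMap.rTensor_tmul, map_add,
    LinearMap.mul'_apply, LinearMap.mul'_apply, map_zero, D.antipode_ι, mul_one] at h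
  exact eq_neg_of_add_eq_zero_left h

theorem eq_top_of_mul_mem (X : Submodule k H) (one : 1 ∈ X)
    (mul_ι : ∀ h ∈ X, ∀ a, h * D.ι a ∈ X)
    (mul_ψ : ∀ h ∈ X, ∀ (g : G) (v : Fin (n g) → k), h * D.ψ g v ∈ X) : X = ⊤ := by
  rw [eq_top_iff, ← Algebra.top_toSubmodule, ← D.generates, Algebra.adjoin_eq_span,
    Submodule.span_le]
  intro x hx
  induction hx using Submonoid.closure_induction_right with
  | one => exact one
  | mul_right x hx y hy ih =>
    rcases hy with ⟨a, rfl⟩ | hy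
    · exact mul_ι x ih a
    · obtain ⟨g, v, rfl⟩ := Set.mem_iUnion.1 hy
      exact mul_ψ x ih g v

theorem exists_euler : ∃ N : H →ₗ[k] H, (∀ a, N (D.ι a) = 0) ∧
    (∀ (g : G) (v : Fin (n g) → k), N (D.ψ g v) = D.ψ g v) ∧
    ∀ x y, N (x * y) = x * N y + N x * y := by
  let ζ : ∀ g : G, (Fin (n g) → k) →ₗ[k] DualNumber H := fun g =>
    (TrivSqZeroExt.inlAlgHom k H H).toLinearMap ∘ₗ D.ψ g +
      (TrivSqZeroExt.inrHom H H).restrictScalars k ∘ₗ D.ψ g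
  obtain ⟨θ, ⟨hι, hψ⟩, -⟩ := D.free (DualNumber H)
    ((TrivSqZeroExt.inlAlgHom k H H : H →* DualNumber H).comp D.ι) ζ
    (fun g hg => by simp [ζ, D.ψ_eq_zero g hg])
    (fun g h _ _ v w => by
      ext
      · simpa [ζ] using D.ψ_mul_ψ g h v w
      · simp [ζ, D.ψ_mul_ψ g h v w])
    (fun g a _ v => by
      ext
      · simpa [ζ] using D.ψ_mul_ι g a v
      · simpa [ζ] using D.ψ_mul_ι g a v)
  have hfst : (TrivSqZeroExt.fstHom k H H).comp θ = AlgHom.id k H := by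
    refine AlgHom.ext_of_adjoin_eq_top D.generates ?_
    rintro _ (⟨a, rfl⟩ | hy)
    · simp [hι]
    · obtain ⟨g, v, rfl⟩ := Set.mem_iUnion.1 hy
      simp [hψ, ζ]
  have hfst' (x : H) : (θ x).fst = x := DFunLike.congr_fun hfst x
  refine ⟨(TrivSqZeroExt.sndHom H H).restrictScalars k ∘ₗ θ.toLinearMap, fun a => ?_,
    fun g v => ?_, fun x y => ?_⟩
  · simp [hι]
  · simp [hψ, ζ]
  · simp [hfst']

/-- The derivation of `H` which multiplies the elements of degree `m` by `m`. -/
def euler : H →ₗ[k] H := D.exists_euler.choose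

@[simp] lemma euler_ι (a : G) : D.euler (D.ι a) = 0 := D.exists_euler.choose_spec.1 a

@[simp] lemma euler_ψ (g : G) (v : Fin (n g) → k) : D.euler (D.ψ g v) = D.ψ g v :=
  D.exists_euler.choose_spec.2.1 g v

lemma euler_mul (x y : H) : D.euler (x * y) = x * D.euler y + D.euler x * y :=
  D.exists_euler.choose_spec.2.2 x y

lemma groupSpan_le_ker_euler : D.groupSpan ≤ LinearMap.ker D.euler :=
  Submodule.span_le.2 (by rintro _ ⟨a, rfl⟩; exact D.euler_ι a)

lemma euler_eq_self {x : H} (hx : x ∈ D.skewSpan) : D.euler x = x := by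
  have : D.skewSpan ≤ LinearMap.eqLocus D.euler LinearMap.id :=
    Submodule.span_le.2 (by rintro _ ⟨a, g, v, rfl⟩; simp [D.euler_mul])
  exact this hx

lemma disjoint_groupSpan_skewSpan : Disjoint D.groupSpan D.skewSpan := by
  rw [Submodule.disjoint_def]
  intro x hx hx'
  rw [← D.euler_eq_self hx']
  exact D.groupSpan_le_ker_euler hx

theorem ker_euler [CharZero k] : LinearMap.ker D.euler = D.groupSpan := by
  have top : D.groupSpan ⊔ ⨆ m : ℕ, Module.End.eigenspace D.euler ((m : k) + 1) = ⊤ := by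
    set T := D.groupSpan ⊔ ⨆ m : ℕ, Module.End.eigenspace D.euler ((m : k) + 1) with hT
    have mul_ι (a : G) : T ≤ T.comap (LinearMap.mulRight k (D.ι a)) := by
      refine sup_le (Submodule.span_le.2 ?_) (iSup_le fun m x hx => ?_)
      · rintro _ ⟨b, rfl⟩
        refine Submodule.mem_sup_left ?_
        simpa using D.ι_mem_groupSpan (b * a)
      · refine Submodule.mem_sup_right (Submodule.mem_iSup_of_mem m ?_)
        rw [Module.End.mem_eigenspace_iff] at hx ⊢
        simp [D.euler_mul, hx]
    have mul_ψ (g : G) (v : Fin (n g) → k) : T ≤ T.comap (LinearMap.mulRight k (D.ψ g v)) := by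
      refine sup_le (fun x hx => ?_) (iSup_le fun m x hx => ?_)
      · refine Submodule.mem_sup_right (Submodule.mem_iSup_of_mem 0 ?_)
        have := LinearMap.mem_ker.1 (D.groupSpan_le_ker_euler hx)
        simp [D.euler_mul, this]
      · refine Submodule.mem_sup_right (Submodule.mem_iSup_of_mem (m + 1) ?_)
        rw [Module.End.mem_eigenspace_iff] at hx ⊢
        simp [D.euler_mul, hx, add_smul, add_mul]
        abel
    exact D.eq_top_of_mul_mem _ (Submodule.mem_sup_left (map_one D.ι ▸ D.ι_mem_groupSpan 1))
      (fun h hh a => mul_ι a hh) (fun h hh g v => mul_ψ g v hh)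
  refine le_antisymm (fun x hx => ?_) D.groupSpan_le_ker_euler
  obtain ⟨y, hy, z, hz, rfl⟩ := Submodule.mem_sup.1 (top ▸ Submodule.mem_top : x ∈ _)
  have hz0 : z ∈ Module.End.eigenspace D.euler 0 := by
    have := D.groupSpan_le_ker_euler hy
    rw [Module.End.eigenspace_zero]
    simpa using Submodule.sub_mem _ hx this
  have hle : ⨆ m : ℕ, Module.End.eigenspace D.euler ((m : k) + 1) ≤
      ⨆ (μ : k) (_ : μ ≠ 0), Module.End.eigenspace D.euler μ :=
    iSup_le fun m => le_iSup₂_of_le ((m : k) + 1) (Nat.cast_add_one_ne_zero m) le_rfl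
  rw [Submodule.disjoint_def.1 (Module.End.eigenspaces_iSupIndep D.euler 0) z hz0 (hle hz),
    add_zero]
  exact hy

/-- The map `h ↦ f(h₁) h₂`. -/
def leftSlice (f : H →ₗ[k] k) : H →ₗ[k] H :=
  (TensorProduct.lid k H).toLinearMap ∘ₗ f.rTensor H ∘ₗ Coalgebra.comul

lemma counit_leftSlice (f : H →ₗ[k] k) (h : H) :
    Coalgebra.counit (R := k) (leftSlice f h) = f h := by
  have key (t : H ⊗[k] H) : Coalgebra.counit (R := k) (TensorProduct.lid k H (f.rTensor H t)) =
      f (TensorProduct.rid k H ((Coalgebra.counit (R := k)).lTensor H t)) := by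
    induction t with
    | zero => simp
    | tmul x y => simp [mul_comm]
    | add s t hs ht => simp only [map_add, hs, ht]
  refine (key _).trans ?_
  simp

lemma leftSlice_mem {C : Submodule k H} (hC : IsSubcoalgebraOf k Coalgebra.comul C)
    (f : H →ₗ[k] k) {x : H} (hx : x ∈ C) : leftSlice f x ∈ C := by
  obtain ⟨t, ht⟩ := hC x hx
  simp only [leftSlice, LinearMap.comp_apply, ← ht]
  clear ht
  induction t with
  | zero => simp
  | tmul y z => simpa using C.smul_mem _ z.2
  | add s t hs ht => simpa using C.add_mem hs ht

@[simp] lemma leftSlice_ι (f : H →ₗ[k] k) (a : G) :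
    leftSlice f (D.ι a) = f (D.ι a) • D.ι a := by
  simp [leftSlice, D.comul_ι]

lemma leftSlice_mul_ψ (f : H →ₗ[k] k) (h : H) (g : G) (v : Fin (n g) → k) :
    leftSlice f (h * D.ψ g v) = leftSlice (f ∘ₗ LinearMap.mulRight k (D.ψ g v)) h +
      leftSlice (f ∘ₗ LinearMap.mulRight k (D.ι g)) h * D.ψ g v := by
  simp only [leftSlice, LinearMap.comp_apply, Bialgebra.comul_mul, D.comul_ψ]
  generalize Coalgebra.comul (R := k) h = t
  induction t with
  | zero => simp
  | tmul x y => simp [mul_add]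
  | add s t hs ht =>
    simp only [add_mul, map_add, hs, ht]
    abel

/-- The filtration of `H` by the number of factors in `𝓑`. -/
def degreeLE : ℕ → Submodule k H
  | 0 => D.groupSpan
  | m + 1 => degreeLE m ⊔ Submodule.span k
      {x : H | ∃ h ∈ degreeLE m, ∃ (g : G) (v : Fin (n g) → k), x = h * D.ψ g v}

lemma degreeLE_le_succ (m : ℕ) : D.degreeLE m ≤ D.degreeLE (m + 1) := le_sup_left

lemma degreeLE_mono : Monotone D.degreeLE := monotone_nat_of_le_succ D.degreeLE_le_succ

lemma mul_ψ_mem_degreeLE {m : ℕ} {h : H} (hh : h ∈ D.degreeLE m) (g : G) (v : Fin (n g) → k) :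
    h * D.ψ g v ∈ D.degreeLE (m + 1) :=
  Submodule.mem_sup_right (Submodule.subset_span ⟨h, hh, g, v, rfl⟩)

lemma mul_ι_mem_degreeLE (m : ℕ) (a : G) {h : H} (hh : h ∈ D.degreeLE m) :
    h * D.ι a ∈ D.degreeLE m := by
  suffices D.degreeLE m ≤ (D.degreeLE m).comap (LinearMap.mulRight k (D.ι a)) from this hh
  clear hh
  induction m with
  | zero =>
    rw [degreeLE]
    refine Submodule.span_le.2 ?_
    rintro _ ⟨b, rfl⟩
    simpa using D.ι_mem_groupSpan (b * a)
  | succ m ih =>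
    refine sup_le (ih.trans (Submodule.comap_mono (D.degreeLE_le_succ m)))
      (Submodule.span_le.2 ?_)
    rintro _ ⟨h, hh, g, v, rfl⟩
    simp only [SetLike.mem_coe, Submodule.mem_comap, LinearMap.mulRight_apply,
      mul_assoc, D.ψ_mul_ι, mul_smul_comm]
    rw [← mul_assoc]
    exact Submodule.smul_mem _ _ (D.mul_ψ_mem_degreeLE (ih hh) g v)

lemma exists_mem_degreeLE (x : H) : ∃ m, x ∈ D.degreeLE m := by
  have : (⨆ m, D.degreeLE m) = ⊤ := by
    have mem {y : H} : y ∈ (⨆ m, D.degreeLE m) ↔ ∃ m, y ∈ D.degreeLE m :=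
      Submodule.mem_iSup_of_directed _ D.degreeLE_mono.directed_le
    refine D.eq_top_of_mul_mem _ (mem.2 ⟨0, map_one D.ι ▸ D.ι_mem_groupSpan 1⟩)
      (fun h hh a => ?_) (fun h hh g v => ?_)
    · obtain ⟨m, hm⟩ := mem.1 hh
      exact mem.2 ⟨m, D.mul_ι_mem_degreeLE m a hm⟩
    · obtain ⟨m, hm⟩ := mem.1 hh
      exact mem.2 ⟨m + 1, D.mul_ψ_mem_degreeLE hm g v⟩
  exact (Submodule.mem_iSup_of_directed _ D.degreeLE_mono.directed_le).1
    (this ▸ Submodule.mem_top : x ∈ ⨆ m, D.degreeLE m)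

lemma leftSlice_mem_degreeLE (m : ℕ) (f : H →ₗ[k] k) {x : H} (hx : x ∈ D.degreeLE m) :
    leftSlice f x ∈ D.degreeLE m := by
  suffices D.degreeLE m ≤ (D.degreeLE m).comap (leftSlice f) from this hx
  clear hx x
  induction m generalizing f with
  | zero =>
    rw [degreeLE]
    refine Submodule.span_le.2 ?_
    rintro _ ⟨b, rfl⟩
    simpa using Submodule.smul_mem _ _ (D.ι_mem_groupSpan b)
  | succ m ih =>
    refine sup_le ((ih f).trans (Submodule.comap_mono (D.degreeLE_le_succ m)))
      (Submodule.span_le.2 ?_)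
    rintro _ ⟨h, hh, g, v, rfl⟩
    simp only [SetLike.mem_coe, Submodule.mem_comap, D.leftSlice_mul_ψ]
    exact add_mem (D.degreeLE_le_succ m (ih _ hh)) (D.mul_ψ_mem_degreeLE (ih _ hh) g v)

lemma leftSlice_eq_zero {f : H →ₗ[k] k} (hf : D.groupSpan ≤ LinearMap.ker f) {x : H}
    (hx : x ∈ D.groupSpan) : leftSlice f x = 0 := by
  refine (Submodule.span_le.2 ?_ : D.groupSpan ≤ LinearMap.ker (leftSlice f)) hx
  rintro _ ⟨b, rfl⟩
  have : f (D.ι b) = 0 := hf (D.ι_mem_groupSpan b)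
  simp [this]

lemma groupSpan_le_ker_comp_mulRight_ι {f : H →ₗ[k] k} (hf : D.groupSpan ≤ LinearMap.ker f)
    (g : G) : D.groupSpan ≤ LinearMap.ker (f ∘ₗ LinearMap.mulRight k (D.ι g)) := by
  refine Submodule.span_le.2 ?_
  rintro _ ⟨b, rfl⟩
  simpa using hf (D.ι_mem_groupSpan (b * g))

lemma leftSlice_mem_degreeLE_of_succ (m : ℕ) {f : H →ₗ[k] k}
    (hf : D.groupSpan ≤ LinearMap.ker f) {x : H} (hx : x ∈ D.degreeLE (m + 1)) :
    leftSlice f x ∈ D.degreeLE m := by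
  suffices D.degreeLE (m + 1) ≤ (D.degreeLE m).comap (leftSlice f) from this hx
  clear hx x
  induction m generalizing f with
  | zero =>
    refine sup_le (fun x hx => ?_) (Submodule.span_le.2 ?_)
    · simp [D.leftSlice_eq_zero hf hx]
    · rintro _ ⟨h, hh, g, v, rfl⟩
      simp only [SetLike.mem_coe, Submodule.mem_comap, D.leftSlice_mul_ψ,
        D.leftSlice_eq_zero (D.groupSpan_le_ker_comp_mulRight_ι hf g) hh, zero_mul, add_zero]
      exact D.leftSlice_mem_degreeLE 0 _ hh
  | succ m ih =>
    refine sup_le ((ih hf).trans (Submodule.comap_mono (D.degreeLE_le_succ m)))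
      (Submodule.span_le.2 ?_)
    rintro _ ⟨h, hh, g, v, rfl⟩
    simp only [SetLike.mem_coe, Submodule.mem_comap, D.leftSlice_mul_ψ]
    exact add_mem (D.leftSlice_mem_degreeLE (m + 1) _ hh)
      (D.mul_ψ_mem_degreeLE (ih (D.groupSpan_le_ker_comp_mulRight_ι hf g) hh) g v)

/-- A nonzero subcoalgebra meets `k[G]` nontrivially. -/
lemma exists_mem_groupSpan {C : Submodule k H} (hC : IsSubcoalgebraOf k Coalgebra.comul C)
    (hC0 : C ≠ ⊥) : ∃ x ∈ C, x ∈ D.groupSpan ∧ x ≠ 0 := by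
  obtain ⟨x, hxC, hx0⟩ := Submodule.exists_mem_ne_zero_of_ne_bot hC0
  obtain ⟨m, hm⟩ := D.exists_mem_degreeLE x
  induction m generalizing x with
  | zero => exact ⟨x, hxC, hm, hx0⟩
  | succ m ih =>
    by_cases hx : x ∈ D.groupSpan
    · exact ⟨x, hxC, hx, hx0⟩
    · obtain ⟨f, hfx, hf⟩ := Submodule.exists_le_ker_of_notMem hx
      refine ih (leftSlice f x) (leftSlice_mem hC f hxC) (fun h => hfx ?_)
        (D.leftSlice_mem_degreeLE_of_succ m hf hm)
      rw [← counit_leftSlice, h, map_zero]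

lemma isSubcoalgebraOf_span_ι (a : G) :
    IsSubcoalgebraOf k Coalgebra.comul (Submodule.span k {(D.ι a : H)}) := by
  intro x hx
  obtain ⟨c, rfl⟩ := Submodule.mem_span_singleton.1 hx
  exact ⟨c • (⟨D.ι a, Submodule.mem_span_singleton_self _⟩ ⊗ₜ
    ⟨D.ι a, Submodule.mem_span_singleton_self _⟩), by simp [D.comul_ι]⟩

theorem exists_coord [Fintype G] [CharZero k] (hF : IsNondegSkewForm k G F) (d : G) :
    ∃ f : H →ₗ[k] k, f (D.ι d) = 1 ∧ (∀ a ≠ d, f (D.ι a) = 0) ∧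
      ∀ (h : H) (g : G) (v : Fin (n g) → k), f (h * D.ψ g v) = 0 := by
  have hχ (g : G) : ∃ θ : H →ₐ[k] H, (∀ a, θ (D.ι a) = algebraMap k H (F g a)) ∧
      ∀ (g' : G) (v : Fin (n g') → k), θ (D.ψ g' v) = 0 := by
    obtain ⟨θ, ⟨h₁, h₂⟩, -⟩ := D.free H
      { toFun := fun a => algebraMap k H (F g a)
        map_one' := by simp [hF.one_right]
        map_mul' := fun a b => by simp [hF.mul_right] } (fun _ => 0)
      (by simp) (by simp) (by simp)
    exact ⟨θ, h₁, h₂⟩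
  choose θ hι hψ using hχ
  have hcard : (Fintype.card G : k) ≠ 0 := Nat.cast_ne_zero.2 Fintype.card_ne_zero
  refine ⟨(Fintype.card G : k)⁻¹ • ∑ g : G, ((F g d : k)⁻¹ •
    (Coalgebra.counit (R := k) ∘ₗ (θ g).toLinearMap)), ?_, fun a ha => ?_, fun h g v => ?_⟩
  · simp [hι, hcard]
  · let χ : G →* k :=
      { toFun := fun g => (F g (d⁻¹ * a) : k)
        map_one' := by simp [hF.one_left]
        map_mul' := fun x y => by simp [hF.mul_left] }
    have hχ1 : χ ≠ 1 := fun h => ha <| by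
      have hone (g : G) : F g (d⁻¹ * a) = 1 := Units.ext (DFunLike.congr_fun h g)
      have := (hF.nondeg 1).unique (y₁ := d⁻¹ * a) (y₂ := 1)
        (fun g => by rw [hF.skew, hone]; simp) (fun g => by simp [hF.one_left])
      exact (inv_mul_eq_one.1 this).symm
    have hinv (g : G) : ((F g d : kˣ) : k)⁻¹ = (F g d⁻¹ : kˣ) := by
      rw [← Units.val_inv_eq_inv_val]
      congr 1
      exact inv_eq_of_mul_eq_one_right (by rw [← hF.mul_right, mul_inv_cancel, hF.one_right])
    have hsum : ∑ g : G, ((F g d : kˣ) : k)⁻¹ * F g a = ∑ g, χ g :=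
      Finset.sum_congr rfl fun g _ => by simp [χ, hF.mul_right, hinv]
    simp [hι, hsum, sum_hom_units_eq_zero χ hχ1]
  · simp [hψ]

/-- The functional on `H` which reads off the coefficient of `d ∈ G`. -/
def coord [Fintype G] [CharZero k] (hF : IsNondegSkewForm k G F) (d : G) : H →ₗ[k] k :=
  (D.exists_coord hF d).choose

section Coord

variable [Fintype G] [CharZero k] (hF : IsNondegSkewForm k G F)

@[simp] lemma coord_ι_self (d : G) : D.coord hF d (D.ι d) = 1 :=
  (D.exists_coord hF d).choose_spec.1

lemma coord_ι_of_ne {a d : G} (h : a ≠ d) : D.coord hF d (D.ι a) = 0 :=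
  (D.exists_coord hF d).choose_spec.2.1 a h

@[simp] lemma coord_mul_ψ (d : G) (h : H) (g : G) (v : Fin (n g) → k) :
    D.coord hF d (h * D.ψ g v) = 0 :=
  (D.exists_coord hF d).choose_spec.2.2 h g v

lemma coord_smul_ι_eq {a d : G} : D.coord hF d (D.ι a) • D.ι a = D.coord hF d (D.ι a) • D.ι d := by
  by_cases h : a = d
  · rw [h]
  · simp [D.coord_ι_of_ne hF h]

lemma leftSlice_coord {x : H} (hx : x ∈ D.groupSpan) (d : G) :
    leftSlice (D.coord hF d) x = D.coord hF d x • D.ι d := by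
  refine (Submodule.span_le.2 ?_ : D.groupSpan ≤ LinearMap.eqLocus (leftSlice (D.coord hF d))
    ((D.coord hF d).smulRight (D.ι d))) hx
  rintro _ ⟨a, rfl⟩
  simpa using D.coord_smul_ι_eq hF

lemma sum_coord {x : H} (hx : x ∈ D.groupSpan) : ∑ d, D.coord hF d x • D.ι d = x := by
  suffices D.groupSpan ≤ LinearMap.eqLocus
      (∑ d, (D.coord hF d).smulRight (D.ι d)) LinearMap.id by simpa using this hx
  refine Submodule.span_le.2 ?_
  rintro _ ⟨a, rfl⟩
  have : ∑ d, D.coord hF d (D.ι a) • D.ι d = D.ι a := by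
    rw [Finset.sum_eq_single a (fun d _ hd => by simp [D.coord_ι_of_ne hF hd.symm]) (by simp)]
    simp
  simpa using this

theorem coradicalOf_eq (hF : IsNondegSkewForm k G F) :
    coradicalOf k (Coalgebra.comul (R := k) (A := H)) = D.groupSpan := by
  refine le_antisymm (sSup_le fun C ⟨hC0, hC, hmin⟩ => ?_) (Submodule.span_le.2 ?_)
  · obtain ⟨x, hxC, hx, hx0⟩ := D.exists_mem_groupSpan hC hC0
    obtain ⟨d, hd⟩ : ∃ d, D.coord hF d x ≠ 0 := by
      by_contra! h
      exact hx0 (by rw [← D.sum_coord hF hx]; simp [h])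
    have hdC : D.ι d ∈ C := by
      have := leftSlice_mem hC (D.coord hF d) hxC
      rw [D.leftSlice_coord hF hx] at this
      exact (C.smul_mem_iff hd).1 this
    rcases hmin _ (D.isSubcoalgebraOf_span_ι d)
      ((Submodule.span_singleton_le_iff_mem _ _).2 hdC) with h | h
    · exact absurd (Submodule.span_singleton_eq_bot.1 h) (D.ι_ne_zero d)
    · rw [← h, Submodule.span_singleton_le_iff_mem]
      exact D.ι_mem_groupSpan d
  · rintro _ ⟨a, rfl⟩
    suffices IsSimpleSubcoalgebraOf k Coalgebra.comul (Submodule.span k {(D.ι a : H)}) from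
      (le_sSup this : _ ≤ coradicalOf k Coalgebra.comul) (Submodule.mem_span_singleton_self _)
    refine ⟨?_, D.isSubcoalgebraOf_span_ι a, fun E _ hE => ?_⟩
    · simpa using D.ι_ne_zero a
    · rw [or_iff_not_imp_left]
      intro hE0
      exact ((nonzero_span_atom _ (D.ι_ne_zero a)).le_iff_eq hE0).1 hE

end Coord

/-- The convolution product of the antipode and the Euler derivation. -/
def eulerProj : H →ₗ[k] H :=
  LinearMap.mul' k H ∘ₗ TensorProduct.map (HopfAlgebra.antipode k) D.euler ∘ₗ Coalgebra.comul

theorem mul_eulerProj_comul (x : H) :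
    LinearMap.mul' k H (D.eulerProj.lTensor H (Coalgebra.comul (R := k) x)) = D.euler x := by
  have h : WithConv.toConv (LinearMap.id : H →ₗ[k] H) *
      (WithConv.toConv (HopfAlgebra.antipode k) * WithConv.toConv D.euler) =
        WithConv.toConv D.euler := by
    rw [← mul_assoc, LinearMap.id_mul_antipode, one_mul]
  exact DFunLike.congr_fun (congrArg WithConv.ofConv h) x

@[simp] lemma eulerProj_ι (a : G) : D.eulerProj (D.ι a) = 0 := by
  simp [eulerProj, D.comul_ι]

lemma eulerProj_mul_ι (h : H) (a : G) :
    D.eulerProj (h * D.ι a) = D.ι a⁻¹ * D.eulerProj h * D.ι a := by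
  simp only [eulerProj, LinearMap.comp_apply, Bialgebra.comul_mul, D.comul_ι]
  generalize Coalgebra.comul (R := k) h = t
  induction t with
  | zero => simp
  | tmul x y => simp [HopfAlgebra.antipode_mul_antidistrib, D.antipode_ι, D.euler_mul, mul_assoc]
  | add s t hs ht => simp only [add_mul, mul_add, map_add, hs, ht]

lemma eulerProj_mul_ψ (h : H) (g : G) (v : Fin (n g) → k) :
    D.eulerProj (h * D.ψ g v) = Coalgebra.counit (R := k) h • (D.ι g⁻¹ * D.ψ g v) +
      D.ι g⁻¹ * (D.eulerProj h * D.ψ g v - D.ψ g v * D.eulerProj h) := by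
  have hε := HopfAlgebra.mul_antipode_rTensor_comul_apply (R := k) h
  rw [← mul_smul_comm, Algebra.smul_def, ← hε]
  simp only [eulerProj, LinearMap.comp_apply, Bialgebra.comul_mul, D.comul_ψ]
  clear hε
  generalize Coalgebra.comul (R := k) h = t
  induction t with
  | zero => simp
  | tmul x y =>
    simp [HopfAlgebra.antipode_mul_antidistrib, D.antipode_ι, D.antipode_ψ, D.euler_mul, mul_assoc,
      mul_add, mul_sub]
    abel
  | add s t hs ht =>
    linear_combination (norm := skip) hs + ht
    simp only [add_mul, mul_add, map_add, mul_sub]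
    abel

/-- The span of the elements `g⁻¹ x`, where `x ∈ V_g`. -/
def normSpan : Submodule k H :=
  Submodule.span k {x : H | ∃ (g : G) (v : Fin (n g) → k), x = D.ι g⁻¹ * D.ψ g v}

lemma eulerProj_mem_normSpan (hF : IsNondegSkewForm k G F) (h : H) :
    D.eulerProj h ∈ D.normSpan := by
  suffices D.normSpan.comap D.eulerProj = ⊤ from (this ▸ Submodule.mem_top : h ∈ _)
  refine D.eq_top_of_mul_mem _ ?_ (fun h hh a => ?_) (fun h hh g v => ?_)
  · rw [Submodule.mem_comap, ← map_one D.ι, D.eulerProj_ι]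
    exact zero_mem _
  · rw [Submodule.mem_comap, D.eulerProj_mul_ι]
    suffices D.normSpan ≤ D.normSpan.comap
      (LinearMap.mulRight k (D.ι a) ∘ₗ LinearMap.mulLeft k (D.ι a⁻¹)) from this hh
    refine Submodule.span_le.2 ?_
    rintro _ ⟨g, v, rfl⟩
    have : D.ι a⁻¹ * (D.ι g⁻¹ * D.ψ g v) * D.ι a = (F a g : k) • (D.ι g⁻¹ * D.ψ g v) := by
      rw [mul_assoc, mul_assoc, D.ψ_mul_ι, mul_smul_comm, mul_smul_comm, ← mul_assoc (D.ι g⁻¹),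
        ← mul_assoc, ← map_mul, ← map_mul, inv_mul_cancel_comm_assoc]
    change D.ι a⁻¹ * (D.ι g⁻¹ * D.ψ g v) * D.ι a ∈ D.normSpan
    rw [this]
    exact D.normSpan.smul_mem _ (Submodule.subset_span ⟨g, v, rfl⟩)
  · have comm : D.eulerProj h * D.ψ g v = D.ψ g v * D.eulerProj h := by
      suffices D.normSpan ≤ LinearMap.eqLocus (LinearMap.mulRight k (D.ψ g v))
        (LinearMap.mulLeft k (D.ψ g v)) from this hh
      refine Submodule.span_le.2 ?_
      rintro _ ⟨g', w, rfl⟩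
      simp only [SetLike.mem_coe, LinearMap.mem_eqLocus, LinearMap.mulRight_apply,
        LinearMap.mulLeft_apply]
      rw [← mul_assoc (D.ψ g v), D.ψ_mul_ι, smul_mul_assoc, mul_assoc, mul_assoc,
        D.ψ_mul_ψ g g' v w, mul_smul_comm, smul_smul, ← Units.val_mul, ← hF.mul_left]
      simp [hF.one_left]
    rw [Submodule.mem_comap, D.eulerProj_mul_ψ, comm, sub_self, mul_zero, add_zero]
    exact D.normSpan.smul_mem _ (Submodule.subset_span ⟨g, v, rfl⟩)

lemma mul_mem_skewSpan {x u : H} (hx : x ∈ D.groupSpan) (hu : u ∈ D.normSpan) :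
    x * u ∈ D.skewSpan := by
  have hι (a : G) : D.ι a * u ∈ D.skewSpan := by
    suffices D.normSpan ≤ D.skewSpan.comap (LinearMap.mulLeft k (D.ι a)) from this hu
    refine Submodule.span_le.2 ?_
    rintro _ ⟨g, v, rfl⟩
    simpa [mul_assoc] using D.ι_mul_ψ_mem_skewSpan (a * g⁻¹) g v
  suffices D.groupSpan ≤ D.skewSpan.comap (LinearMap.mulRight k u) from this hx
  refine Submodule.span_le.2 ?_
  rintro _ ⟨a, rfl⟩
  exact hι a

/-- The subspace `k[G] ⊗ H + H ⊗ k[G]`. -/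
def wedgeSpan : Submodule k (H ⊗[k] H) :=
  LinearMap.range (TensorProduct.map D.groupSpan.subtype (LinearMap.id (M := H))) ⊔
    LinearMap.range (TensorProduct.map (LinearMap.id (M := H)) D.groupSpan.subtype)

lemma ι_tmul_mem_wedgeSpan (a : G) (x : H) : D.ι a ⊗ₜ[k] x ∈ D.wedgeSpan :=
  Submodule.mem_sup_left ⟨⟨D.ι a, D.ι_mem_groupSpan a⟩ ⊗ₜ x, rfl⟩

lemma tmul_ι_mem_wedgeSpan (a : G) (x : H) : x ⊗ₜ[k] D.ι a ∈ D.wedgeSpan :=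
  Submodule.mem_sup_right ⟨x ⊗ₜ ⟨D.ι a, D.ι_mem_groupSpan a⟩, rfl⟩

lemma euler_mem_skewSpan (hF : IsNondegSkewForm k G F) {x : H}
    (hx : Coalgebra.comul (R := k) x ∈ D.wedgeSpan) :
    D.euler x ∈ D.skewSpan := by
  rw [← D.mul_eulerProj_comul]
  suffices D.wedgeSpan ≤ D.skewSpan.comap (LinearMap.mul' k H ∘ₗ D.eulerProj.lTensor H) from
    this hx
  refine sup_le ?_ ?_
  · rintro _ ⟨t, rfl⟩
    induction t with
    | zero => simp
    | tmul y z => exact D.mul_mem_skewSpan y.2 (D.eulerProj_mem_normSpan hF z)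
    | add s t hs ht => rw [map_add]; exact add_mem hs ht
  · have hP : D.groupSpan ≤ LinearMap.ker D.eulerProj :=
      Submodule.span_le.2 (by rintro _ ⟨a, rfl⟩; exact D.eulerProj_ι a)
    rintro _ ⟨t, rfl⟩
    induction t with
    | zero => simp
    | tmul y z => simp [LinearMap.mem_ker.1 (hP z.2)]
    | add s t hs ht => rw [map_add]; exact add_mem hs ht

lemma comul_ι_mul_ψ (a g : G) (v : Fin (n g) → k) :
    Coalgebra.comul (R := k) (D.ι a * D.ψ g v) =
      (D.ι a * D.ψ g v) ⊗ₜ[k] D.ι a + D.ι (a * g) ⊗ₜ[k] (D.ι a * D.ψ g v) := by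
  simp [Bialgebra.comul_mul, D.comul_ι, D.comul_ψ, mul_add]

/-- The map `h ↦ h₁ f(h₂)`. -/
def rightSlice (f : H →ₗ[k] k) : H →ₗ[k] H :=
  (TensorProduct.rid k H).toLinearMap ∘ₗ f.lTensor H ∘ₗ Coalgebra.comul

/-- The translate `a V_{a⁻¹b}` of a space of skew primitive generators. -/
def translate (a b : G) : Submodule k H :=
  Submodule.span k {x : H | ∃ v : Fin (n (a⁻¹ * b)) → k, x = D.ι a * D.ψ (a⁻¹ * b) v}

lemma translate_le_skewSpan (a b : G) : D.translate a b ≤ D.skewSpan :=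
  Submodule.span_mono fun _ ⟨v, hv⟩ => ⟨a, _, v, hv⟩

lemma counit_eq_zero_of_mem_skewSpan {x : H} (hx : x ∈ D.skewSpan) :
    Coalgebra.counit (R := k) x = 0 := by
  refine (Submodule.span_le.2 ?_ : D.skewSpan ≤ LinearMap.ker (Coalgebra.counit (R := k))) hx
  rintro _ ⟨a, g, v, rfl⟩
  simp [Bialgebra.counit_mul, D.counit_ψ]

lemma mem_skewPrimitives_iff {a b x : H} : x ∈ skewPrimitives k H a b ↔
    Coalgebra.comul (R := k) x = x ⊗ₜ[k] a + b ⊗ₜ[k] x := by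
  simp [skewPrimitives, sub_eq_zero]

lemma counit_eq_zero_of_comul {a b : G} {x : H}
    (hx : Coalgebra.comul (R := k) x = x ⊗ₜ[k] D.ι a + D.ι b ⊗ₜ[k] x) :
    Coalgebra.counit (R := k) x = 0 := by
  have h := Coalgebra.rTensor_counit_comul (R := k) x
  rw [hx, map_add, LinearMap.rTensor_tmul, LinearMap.rTensor_tmul, D.counit_ι,
    add_eq_right] at h
  simpa [D.counit_ι] using congrArg (fun t => LinearMap.mul' k k (Coalgebra.counit.lTensor k t)) h

section Main

variable [Fintype G] [CharZero k] (hF : IsNondegSkewForm k G F)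

theorem firstCoradicalTermOf_eq (hF : IsNondegSkewForm k G F) :
    firstCoradicalTermOf k (Coalgebra.comul (R := k) (A := H)) = D.groupSpan ⊔ D.skewSpan := by
  have hfirst : firstCoradicalTermOf k (Coalgebra.comul (R := k) (A := H)) =
      D.wedgeSpan.comap Coalgebra.comul := by
    rw [firstCoradicalTermOf, D.coradicalOf_eq hF, wedgeSpan]
  rw [hfirst]
  refine le_antisymm (fun x hx => ?_) (sup_le (Submodule.span_le.2 ?_) (Submodule.span_le.2 ?_))
  · have hN := D.euler_mem_skewSpan hF hx
    have hx0 : x - D.euler x ∈ D.groupSpan := by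
      rw [← D.ker_euler, LinearMap.mem_ker, map_sub, D.euler_eq_self hN, sub_self]
    exact sub_add_cancel x (D.euler x) ▸ Submodule.add_mem_sup hx0 hN
  · rintro _ ⟨a, rfl⟩
    simpa [D.comul_ι] using D.ι_tmul_mem_wedgeSpan a (D.ι a)
  · rintro _ ⟨a, g, v, rfl⟩
    rw [SetLike.mem_coe, Submodule.mem_comap, D.comul_ι_mul_ψ]
    exact add_mem (D.tmul_ι_mem_wedgeSpan _ _) (D.ι_tmul_mem_wedgeSpan _ _)

lemma rightSlice_coord_ι_mul_mem_translate (a b : G) {u : H} (hu : u ∈ D.normSpan) :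
    rightSlice (D.coord hF a) (D.ι b * u) ∈ D.translate a b := by
  suffices D.normSpan ≤ (D.translate a b).comap
    (rightSlice (D.coord hF a) ∘ₗ LinearMap.mulLeft k (D.ι b)) from this hu
  refine Submodule.span_le.2 ?_
  rintro _ ⟨g, v, rfl⟩
  have : rightSlice (D.coord hF a) (D.ι b * (D.ι g⁻¹ * D.ψ g v)) =
      D.coord hF a (D.ι (b * g⁻¹)) • (D.ι (b * g⁻¹) * D.ψ g v) := by
    rw [← mul_assoc, ← map_mul, rightSlice, LinearMap.comp_apply, LinearMap.comp_apply,
      D.comul_ι_mul_ψ]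
    simp
  simp only [SetLike.mem_coe, Submodule.mem_comap, LinearMap.comp_apply, LinearMap.mulLeft_apply,
    this]
  by_cases h : b * g⁻¹ = a
  · obtain rfl : g = a⁻¹ * b := by rw [← h]; group
    rw [h]
    exact Submodule.smul_mem _ _ (Submodule.subset_span ⟨v, rfl⟩)
  · rw [D.coord_ι_of_ne hF h, zero_smul]
    exact zero_mem _

lemma rightSlice_coord_of_mem_groupSpan {x : H} (hx : x ∈ D.groupSpan) (d : G) :
    rightSlice (D.coord hF d) x = D.coord hF d x • D.ι d := by
  refine (Submodule.span_le.2 ?_ : D.groupSpan ≤ LinearMap.eqLocus (rightSlice (D.coord hF d))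
    ((D.coord hF d).smulRight (D.ι d))) hx
  rintro _ ⟨a, rfl⟩
  simpa [rightSlice, D.comul_ι] using D.coord_smul_ι_eq hF

theorem skewPrimitives_eq (hF : IsNondegSkewForm k G F) (a b : G) :
    skewPrimitives k H (D.ι a) (D.ι b) =
      Submodule.span k {(D.ι a : H) - D.ι b} ⊔ D.translate a b := by
  refine le_antisymm (fun x hx => ?_) (sup_le ?_ (Submodule.span_le.2 ?_))
  · rw [mem_skewPrimitives_iff] at hx
    have hw : D.euler x ∈ D.skewSpan := D.euler_mem_skewSpan hF <| by
      rw [hx]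
      exact add_mem (D.tmul_ι_mem_wedgeSpan a x) (D.ι_tmul_mem_wedgeSpan b x)
    have hy : x - D.euler x ∈ D.groupSpan := by
      rw [← D.ker_euler, LinearMap.mem_ker, map_sub, D.euler_eq_self hw, sub_self]
    have hwb : D.euler x = D.ι b * D.eulerProj x := by
      rw [← D.mul_eulerProj_comul, hx]
      simp
    have hE : rightSlice (D.coord hF a) (D.euler x) ∈ D.translate a b := by
      rw [hwb]
      exact D.rightSlice_coord_ι_mul_mem_translate hF a b (D.eulerProj_mem_normSpan hF x)
    have hEx : rightSlice (D.coord hF a) x = x + D.coord hF a x • D.ι b := by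
      simp [rightSlice, hx]
    have hEy := D.rightSlice_coord_of_mem_groupSpan hF hy a
    rw [map_sub, hEx] at hEy
    set s := D.coord hF a (x - D.euler x)
    set t := D.coord hF a x
    set w := D.euler x
    have hzero : w - rightSlice (D.coord hF a) w = 0 := by
      refine Submodule.disjoint_def.1 D.disjoint_groupSpan_skewSpan _ ?_
        (sub_mem hw (D.translate_le_skewSpan a b hE))
      have : w - rightSlice (D.coord hF a) w = s • D.ι a - t • D.ι b - (x - w) := by
        rw [← hEy]; abel
      rw [this]
      exact sub_mem (sub_mem (Submodule.smul_mem _ _ (D.ι_mem_groupSpan a))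
        (Submodule.smul_mem _ _ (D.ι_mem_groupSpan b))) hy
    have hyst : x - w = s • D.ι a - t • D.ι b := by
      rw [← hEy, ← sub_eq_zero.1 hzero]; abel
    have hst : s = t := by
      have := congrArg (Coalgebra.counit (R := k)) hyst
      simp only [map_sub, map_smul, D.counit_ι, D.counit_eq_zero_of_comul hx,
        D.counit_eq_zero_of_mem_skewSpan hw] at this
      exact sub_eq_zero.1 (by simpa using this.symm)
    rw [← sub_add_cancel x w]
    refine Submodule.add_mem_sup ?_ (sub_eq_zero.1 hzero ▸ hE)
    rw [hyst, hst, ← smul_sub]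
    exact Submodule.smul_mem _ _ (Submodule.mem_span_singleton_self _)
  · rw [Submodule.span_singleton_le_iff_mem, mem_skewPrimitives_iff]
    simp [D.comul_ι, TensorProduct.sub_tmul, TensorProduct.tmul_sub]
  · rintro _ ⟨v, rfl⟩
    rw [SetLike.mem_coe, mem_skewPrimitives_iff, D.comul_ι_mul_ψ, mul_inv_cancel_left]

end Main

end HDPresentation

end Presentation

/-- Let `D = (G,F,n)` be a datum over an algebraically closed field `k`
of characteristic `0` and `H(D)` the associated Hopf algebra. Then the first term of the
coradical filtration of `H(D)` is `H(D)₁ = k[G] ⊕ (k[G]𝓑)`, and for all `a, b ∈ G` the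
space of `a:b` skew primitives is `P_{a,b}(H(D)) = sp_k{a−b} ⊕ a V_{a⁻¹b}` (where
`V_{a⁻¹b} = 0` if `a⁻¹b ∉ I_F`). -/
theorem HD_coradical_filtration_and_skew_primitives
    (k : Type u) [Field k] [IsAlgClosed k] [CharZero k]
    (G : Type w) [CommGroup G] [Fintype G] (F : G → G → kˣ) (n : G → ℕ)
    (hF : IsNondegSkewForm k G F)
    (H : Type v) [Ring H] [HopfAlgebra k H] (D : HDPresentation k G F n H) :
    (firstCoradicalTermOf k (Coalgebra.comul (R := k) (A := H)) =
        Submodule.span k (Set.range ⇑D.ι) ⊔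
          Submodule.span k
            {x : H | ∃ (a g : G) (v : Fin (n g) → k), x = D.ι a * D.ψ g v} ∧
      Disjoint (Submodule.span k (Set.range ⇑D.ι))
        (Submodule.span k
          {x : H | ∃ (a g : G) (v : Fin (n g) → k), x = D.ι a * D.ψ g v})) ∧
    ∀ a b : G,
      skewPrimitives k H (D.ι a) (D.ι b) =
        Submodule.span k {(D.ι a : H) - D.ι b} ⊔
          Submodule.span k
            {x : H | ∃ v : Fin (n (a⁻¹ * b)) → k, x = D.ι a * D.ψ (a⁻¹ * b) v} ∧
      Disjoint (Submodule.span k {(D.ι a : H) - D.ι b})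
        (Submodule.span k
          {x : H | ∃ v : Fin (n (a⁻¹ * b)) → k, x = D.ι a * D.ψ (a⁻¹ * b) v}) := by
  refine ⟨⟨D.firstCoradicalTermOf_eq hF, D.disjoint_groupSpan_skewSpan⟩, fun a b =>
    ⟨D.skewPrimitives_eq hF a b, D.disjoint_groupSpan_skewSpan.mono ?_
      (D.translate_le_skewSpan a b)⟩⟩
  rw [Submodule.span_singleton_le_iff_mem]
  exact sub_mem (D.ι_mem_groupSpan a) (D.ι_mem_groupSpan b)

end Paper
end
end

section
/- Let D = (G,F,n) be a datum over an algebraically closed field k of characteristic 0. If n_{g⁻¹} ≠ n_g for some g ∈ I_F' := {g ∈ I_F | n_g ≠ 0}, then H(D) does not admit a minimal triangular structure. -/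
open TensorProduct

noncomputable section

universe u v w

namespace Paper

variable (k : Type*) [Field k]

section TensorDual

variable {k} {M N : Type*} [AddCommGroup M] [Module k M] [AddCommGroup N] [Module k N]

theorem tensor_ext_dual {s t : M ⊗[k] N}
    (h : ∀ (p : Module.Dual k M) (q : Module.Dual k N),
      dualDistrib k M N (p ⊗ₜ q) s = dualDistrib k M N (p ⊗ₜ q) t) : s = t := by
  let bM := Module.Basis.ofVectorSpace k M
  let bN := Module.Basis.ofVectorSpace k N
  have key : ∀ (t : M ⊗[k] N) ij, (bM.tensorProduct bN).repr t ij =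
      dualDistrib k M N (bM.coord ij.1 ⊗ₜ bN.coord ij.2) t := by
    rintro t ⟨i, j⟩
    induction t with
    | zero => simp
    | tmul x y => rw [Module.Basis.tensorProduct_repr_tmul_apply]; simp [mul_comm]
    | add x y hx hy => simp [hx, hy]
  refine (bM.tensorProduct bN).ext_elem fun ij => ?_
  rw [key, key, h]

theorem exists_fintype_sum_tmul (t : M ⊗[k] N) :
    ∃ (m : ℕ) (a : Fin m → M) (b : Fin m → N), t = ∑ i, a i ⊗ₜ[k] b i := by
  obtain ⟨S, hS⟩ := TensorProduct.exists_finset t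
  refine ⟨S.card, fun i => (S.equivFin.symm i).1.1, fun i => (S.equivFin.symm i).1.2, ?_⟩
  rw [hS, ← Finset.sum_coe_sort, ← S.equivFin.symm.sum_comp]

end TensorDual

section Slice

variable {k} {A : Type*} [AddCommGroup A] [Module k A] {m : ℕ}

/-- The map `p ↦ ∑ p(aᵢ) bᵢ` given by contracting the first leg of `∑ aᵢ ⊗ bᵢ`. -/
def slice (a b : Fin m → A) : Module.Dual k A →ₗ[k] A :=
  ∑ i, (Module.Dual.eval k A (a i)).smulRight (b i)

theorem slice_apply (a b : Fin m → A) (p : Module.Dual k A) :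
    slice a b p = ∑ i, p (a i) • b i := by
  simp [slice]

theorem dual_slice_comm (a b : Fin m → A) (p q : Module.Dual k A) :
    q (slice a b p) = p (slice b a q) := by
  simp [slice_apply, mul_comm]

theorem dualDistrib_sum_tmul (a b : Fin m → A) (p q : Module.Dual k A) :
    dualDistrib k A A (p ⊗ₜ q) (∑ i, a i ⊗ₜ[k] b i) = q (slice a b p) := by
  simp [slice_apply]

theorem finite_range_slice (a b : Fin m → A) :
    Module.Finite k (LinearMap.range (slice (k := k) a b)) := by
  have h : LinearMap.range (slice (k := k) a b) ≤ Submodule.span k (Set.range b) := by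
    rintro _ ⟨p, rfl⟩
    rw [slice_apply]
    exact Submodule.sum_mem _ fun i _ =>
      Submodule.smul_mem _ _ (Submodule.subset_span ⟨i, rfl⟩)
  have : Module.Finite k (Submodule.span k (Set.range b)) :=
    Module.Finite.span_of_finite k (Set.finite_range b)
  exact Submodule.finiteDimensional_of_le h

/-- If both slices of `∑ aᵢ ⊗ bᵢ` land in `K`, then the components may be chosen in `K`. -/
theorem exists_components_mem (a b : Fin m → A) (K : Submodule k A)
    (h₁ : LinearMap.range (slice (k := k) a b) ≤ K)
    (h₂ : LinearMap.range (slice (k := k) b a) ≤ K) :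
    ∃ a' b' : Fin m → A, (∀ i, a' i ∈ K) ∧ (∀ i, b' i ∈ K) ∧
      ∑ i, a i ⊗ₜ[k] b i = ∑ i, a' i ⊗ₜ[k] b' i := by
  obtain ⟨π, hπ⟩ := K.exists_isCompl
  let T : A →ₗ[k] A := K.subtype ∘ₗ K.projectionOnto π hπ
  have hT : ∀ x ∈ K, T x = x := fun x hx => by
    simpa [T] using congrArg Subtype.val (Submodule.projectionOnto_apply_left hπ ⟨x, hx⟩)
  refine ⟨T ∘ a, T ∘ b, fun i => Subtype.property _, fun i => Subtype.property _, ?_⟩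
  refine tensor_ext_dual fun p q => ?_
  have e₁ : ∀ p : Module.Dual k A, slice a (T ∘ b) p = slice a b p := by
    intro p
    rw [← hT (slice a b p) (h₁ ⟨p, rfl⟩)]
    simp [slice_apply]
  have e₂ : ∀ q : Module.Dual k A, slice (T ∘ b) (T ∘ a) q = slice (T ∘ b) a q := by
    intro q
    have : slice (T ∘ b) a q = slice b a (q ∘ₗ T) := by simp [slice_apply]
    rw [this, ← hT (slice b a _) (h₂ ⟨_, rfl⟩)]
    simp [slice_apply]
  rw [dualDistrib_sum_tmul, dualDistrib_sum_tmul, dual_slice_comm (T ∘ a), e₂, ← e₁,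
    dual_slice_comm]

end Slice

section RMatrix

variable {k} {A : Type*} [Ring A] [HopfAlgebra k A] {m : ℕ}
variable (Q : QuasiTriangular k A) (a b : Fin m → A)

open Coalgebra

theorem QuasiTriangular.hexagon₁_sum (hR : Q.R = ∑ i, a i ⊗ₜ[k] b i) :
    ∑ i, comul (R := k) (a i) ⊗ₜ[k] b i = ∑ i, ∑ j, (a i ⊗ₜ[k] a j) ⊗ₜ[k] (b i * b j) := by
  have h := Q.hexagon₁
  unfold Hexagon₁ at h
  rw [hR] at h
  simpa [Finset.sum_mul_sum] using h

theorem QuasiTriangular.hexagon₂_sum (hR : Q.R = ∑ i, a i ⊗ₜ[k] b i) :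
    ∑ i, a i ⊗ₜ[k] comul (R := k) (b i) = ∑ i, ∑ j, (a i * a j) ⊗ₜ[k] (b j ⊗ₜ[k] b i) := by
  have h := Q.hexagon₂
  unfold Hexagon₂ at h
  rw [hR] at h
  simpa [Finset.sum_mul_sum] using h

theorem slice_counit (hR : Q.R = ∑ i, a i ⊗ₜ[k] b i) : slice a b (counit (R := k)) = 1 := by
  have h := congrArg (TensorProduct.map
    ((TensorProduct.lid k A).toLinearMap ∘ₗ TensorProduct.map (counit (R := k)) LinearMap.id)
    (LinearMap.id (M := A))) (Q.hexagon₁_sum a b hR)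
  have e : ∀ x : A, (TensorProduct.lid k A)
      (TensorProduct.map (counit (R := k)) LinearMap.id (comul (R := k) x)) = x := fun x => by
    have := rTensor_counit_comul (R := k) x
    rw [LinearMap.rTensor] at this
    rw [this]; simp
  have h' : Q.R = (1 ⊗ₜ[k] slice a b (counit (R := k))) * Q.R := by
    have : (1 ⊗ₜ[k] slice a b (counit (R := k))) * Q.R =
        ∑ i, ∑ j, (counit (R := k) (a i) • a j) ⊗ₜ[k] (b i * b j) := by
      rw [hR, slice_apply, tmul_sum, Finset.sum_mul_sum]
      simp [smul_tmul']
    rw [this]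
    simpa [e, hR] using h
  have h1 : (1 : A ⊗[k] A) = 1 ⊗ₜ[k] slice a b (counit (R := k)) :=
    Q.isUnit.mul_right_cancel (by rw [one_mul]; exact h')
  have h2 := congrArg ((TensorProduct.lid k A).toLinearMap ∘ₗ
    TensorProduct.map (counit (R := k)) LinearMap.id) h1
  simpa [Algebra.TensorProduct.one_def] using h2.symm

theorem slice_mul (hR : Q.R = ∑ i, a i ⊗ₜ[k] b i) (p q : Module.Dual k A) :
    slice a b p * slice a b q =
      slice a b (dualDistrib k A A (p ⊗ₜ q) ∘ₗ comul (R := k)) := by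
  have h := congrArg ((TensorProduct.lid k A).toLinearMap ∘ₗ
    TensorProduct.map (dualDistrib k A A (p ⊗ₜ q)) LinearMap.id) (Q.hexagon₁_sum a b hR)
  simp only [slice_apply, Finset.sum_mul_sum]
  simpa [smul_smul, mul_comm] using h.symm

theorem comul_slice (hR : Q.R = ∑ i, a i ⊗ₜ[k] b i) (p : Module.Dual k A) :
    comul (R := k) (slice a b p) = ∑ i, ∑ j, p (a i * a j) • (b j ⊗ₜ[k] b i) := by
  have h := congrArg ((TensorProduct.lid k (A ⊗[k] A)).toLinearMap ∘ₗ
    TensorProduct.map p LinearMap.id) (Q.hexagon₂_sum a b hR)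
  simp only [slice_apply, map_sum, map_smul]
  simpa using h

theorem dual_slice_mul_slice (hR : Q.R = ∑ i, a i ⊗ₜ[k] b i) (p q q' : Module.Dual k A) :
    p (slice b a q' * slice b a q) =
      dualDistrib k A A (q ⊗ₜ q') (comul (R := k) (slice a b p)) := by
  rw [comul_slice Q a b hR]
  simp only [slice_apply, Finset.sum_mul_sum, map_sum, map_smul, dualDistrib_apply, smul_mul_smul,
    smul_eq_mul]
  refine Finset.sum_congr rfl fun i _ => Finset.sum_congr rfl fun j _ => ?_
  ring

theorem antipode_slice (hT : Q.IsTriangular) (hR : Q.R = ∑ i, a i ⊗ₜ[k] b i) :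
    TensorProduct.map (HopfAlgebra.antipode k (A := A)) LinearMap.id Q.R =
      TensorProduct.comm k A A Q.R := by
  have h := congrArg (TensorProduct.map
    (LinearMap.mul' k A ∘ₗ TensorProduct.map (HopfAlgebra.antipode k) LinearMap.id)
    (LinearMap.id (M := A))) (Q.hexagon₁_sum a b hR)
  have e : ∀ x : A, LinearMap.mul' k A
      (TensorProduct.map (HopfAlgebra.antipode k) LinearMap.id (comul (R := k) x)) =
        algebraMap k A (counit x) := fun x => by
    have := HopfAlgebra.mul_antipode_rTensor_comul_apply (R := k) x
    rwa [LinearMap.rTensor] at this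
  have h1 : TensorProduct.map (HopfAlgebra.antipode k (A := A)) LinearMap.id Q.R * Q.R = 1 := by
    have hc := slice_counit Q a b hR
    have e2 : ∑ i, algebraMap k A (counit (a i)) ⊗ₜ[k] b i = (1 : A ⊗[k] A) := by
      conv_rhs => rw [Algebra.TensorProduct.one_def]; enter [3]; rw [← hc, slice_apply]
      rw [tmul_sum]
      simp [Algebra.algebraMap_eq_smul_one, smul_tmul]
    rw [← e2, hR]
    simp only [map_sum, TensorProduct.map_tmul, LinearMap.comp_apply, e] at h
    simpa [Finset.sum_mul_sum] using h.symm
  exact left_inv_eq_right_inv h1 hT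

theorem slice_right_eq (hT : Q.IsTriangular) (hR : Q.R = ∑ i, a i ⊗ₜ[k] b i)
    (p : Module.Dual k A) :
    slice b a p = slice a b (p ∘ₗ HopfAlgebra.antipode k) := by
  have h := congrArg ((TensorProduct.lid k A).toLinearMap ∘ₗ
    TensorProduct.map p LinearMap.id) (antipode_slice Q a b hT hR)
  rw [hR] at h
  simpa [slice_apply] using h.symm

theorem slice_left_eq (hT : Q.IsTriangular) (hR : Q.R = ∑ i, a i ⊗ₜ[k] b i)
    (p : Module.Dual k A) :
    slice a b p = HopfAlgebra.antipode k (slice b a p) := by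
  have h := congrArg ((TensorProduct.rid k A).toLinearMap ∘ₗ
    TensorProduct.map LinearMap.id p) (antipode_slice Q a b hT hR)
  rw [hR] at h
  simpa [slice_apply] using h.symm

theorem range_slice_comm (hT : Q.IsTriangular) (hR : Q.R = ∑ i, a i ⊗ₜ[k] b i) :
    LinearMap.range (slice (k := k) b a) = LinearMap.range (slice (k := k) a b) := by
  have := finite_range_slice (k := k) a b
  have := finite_range_slice (k := k) b a
  refine Submodule.eq_of_le_of_finrank_le ?_ ?_
  · rintro _ ⟨p, rfl⟩
    exact ⟨_, (slice_right_eq Q a b hT hR p).symm⟩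
  · have h : LinearMap.range (slice (k := k) a b) ≤
        (LinearMap.range (slice (k := k) b a)).map (HopfAlgebra.antipode k) := by
      rintro _ ⟨p, rfl⟩
      exact ⟨_, ⟨p, rfl⟩, (slice_left_eq Q a b hT hR p).symm⟩
    exact (Submodule.finrank_mono h).trans (Submodule.finrank_map_le _ _)

/-- For a minimal triangular structure `∑ aᵢ ⊗ bᵢ` the contraction `A* → A` is onto. -/
theorem slice_surjective (hT : Q.IsTriangular) (hM : Q.IsMinimal)
    (hR : Q.R = ∑ i, a i ⊗ₜ[k] b i) : Function.Surjective (slice (k := k) a b) := by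
  have hcomm := range_slice_comm Q a b hT hR
  obtain ⟨a', b', ha', hb', hab⟩ := exists_components_mem a b
    (LinearMap.range (slice (k := k) a b)) le_rfl hcomm.le
  have hR' := hR.trans hab
  have hs : slice (k := k) a b = slice a' b' := by
    ext p
    have h := congrArg ((TensorProduct.lid k A).toLinearMap ∘ₗ
      TensorProduct.map p LinearMap.id) hab
    simpa [slice_apply] using h
  let B : Subalgebra k A := (LinearMap.range (slice (k := k) a b)).toSubalgebra
    ⟨_, slice_counit Q a b hR⟩ (by
      rintro _ _ ⟨p, rfl⟩ ⟨q, rfl⟩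
      exact ⟨_, (slice_mul Q a b hR p q).symm⟩)
  have hB : B = ⊤ := by
    refine hM B ⟨?_, ?_⟩ ?_
    · rintro _ ⟨p, rfl⟩
      rw [hs, comul_slice Q a' b' hR']
      exact Submodule.sum_mem _ fun i _ => Submodule.sum_mem _ fun j _ =>
        Submodule.smul_mem _ _ ⟨⟨b' j, hb' j⟩ ⊗ₜ ⟨b' i, hb' i⟩, rfl⟩
    · intro x hx
      have hx' : x ∈ LinearMap.range (slice (k := k) a b) := hx
      rw [← hcomm] at hx'
      obtain ⟨p, rfl⟩ := hx'
      exact ⟨p, slice_left_eq Q a b hT hR p⟩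
    · unfold MemTensorSquare
      rw [hR']
      exact Submodule.sum_mem _ fun i _ => ⟨⟨a' i, ha' i⟩ ⊗ₜ ⟨b' i, hb' i⟩, rfl⟩
  intro x
  have hx : x ∈ B := hB ▸ Algebra.mem_top
  exact hx

theorem slice_bijective (hT : Q.IsTriangular) (hM : Q.IsMinimal)
    (hR : Q.R = ∑ i, a i ⊗ₜ[k] b i) : Function.Bijective (slice (k := k) a b) := by
  have hs := slice_surjective Q a b hT hM hR
  refine ⟨(injective_iff_map_eq_zero _).2 fun p hp => ?_, hs⟩
  ext x
  have hx : x ∈ LinearMap.range (slice (k := k) b a) := by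
    rw [range_slice_comm Q a b hT hR]; exact hs x
  obtain ⟨q, rfl⟩ := hx
  rw [← dual_slice_comm, hp]; simp

theorem slice_right_surjective (hT : Q.IsTriangular) (hM : Q.IsMinimal)
    (hR : Q.R = ∑ i, a i ⊗ₜ[k] b i) : Function.Surjective (slice (k := k) b a) := by
  rw [← LinearMap.range_eq_top, range_slice_comm Q a b hT hR, LinearMap.range_eq_top]
  exact slice_surjective Q a b hT hM hR

theorem slice_right_counit (hT : Q.IsTriangular) (hR : Q.R = ∑ i, a i ⊗ₜ[k] b i) :
    slice b a (counit (R := k)) = 1 := by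
  rw [slice_right_eq Q a b hT hR, HopfAlgebra.counit_comp_antipode, slice_counit Q a b hR]

/-- Under `A* ≅ A`, grouplike elements correspond to characters. -/
theorem exists_character_of_isGrouplike (hT : Q.IsTriangular) (hM : Q.IsMinimal)
    (hR : Q.R = ∑ i, a i ⊗ₜ[k] b i) {x : A} (hx : IsGrouplike k A x) :
    ∃ χ : A →ₐ[k] k, slice a b χ.toLinearMap = x := by
  obtain ⟨p, rfl⟩ := slice_surjective Q a b hT hM hR x
  have hs := slice_right_surjective Q a b hT hM hR
  refine ⟨AlgHom.ofLinearMap p ?_ ?_, rfl⟩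
  · rw [← slice_right_counit Q a b hT hR, ← dual_slice_comm, hx.1]
  · intro y z
    obtain ⟨q', rfl⟩ := hs y
    obtain ⟨q, rfl⟩ := hs z
    rw [dual_slice_mul_slice Q a b hR, hx.2, dualDistrib_apply, dual_slice_comm, mul_comm,
      dual_slice_comm a b p q']

/-- Under `A* ≅ A`, skew primitive elements correspond to skew derivations. -/
theorem dual_mul_of_isSkewPrimitive (hT : Q.IsTriangular) (hM : Q.IsMinimal)
    (hR : Q.R = ∑ i, a i ⊗ₜ[k] b i) {p : Module.Dual k A} {χ : A →ₐ[k] k}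
    (hp : IsSkewPrimitive k A 1 (slice a b χ.toLinearMap) (slice a b p)) (y z : A) :
    p (y * z) = p y * χ z + counit (R := k) y * p z := by
  have hs := slice_right_surjective Q a b hT hM hR
  obtain ⟨q', rfl⟩ := hs y
  obtain ⟨q, rfl⟩ := hs z
  rw [dual_slice_mul_slice Q a b hR, hp, map_add, dualDistrib_apply, dualDistrib_apply,
    ← slice_counit Q a b hR]
  simp only [dual_slice_comm a b _ q, dual_slice_comm a b _ q', AlgHom.toLinearMap_apply]
  ring

theorem character_slice_mul (hT : Q.IsTriangular) (hR : Q.R = ∑ i, a i ⊗ₜ[k] b i)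
    (χ χ' : A →ₐ[k] k) :
    χ' (slice a b χ.toLinearMap) * χ (slice a b χ'.toLinearMap) = 1 := by
  have h := congrArg (dualDistrib k A A (χ.toLinearMap ⊗ₜ χ'.toLinearMap)) hT
  rw [hR] at h
  simp only [map_sum, TensorProduct.comm_tmul, Finset.sum_mul_sum,
    Algebra.TensorProduct.tmul_mul_tmul, dualDistrib_apply, AlgHom.toLinearMap_apply, map_mul,
    Algebra.TensorProduct.one_def, map_one, mul_one] at h
  rw [← h]
  simp only [slice_apply, map_sum, map_smul, Finset.sum_mul_sum, AlgHom.toLinearMap_apply,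
    smul_eq_mul]
  refine Finset.sum_congr rfl fun i _ => Finset.sum_congr rfl fun j _ => ?_
  ring

theorem skewPrimitive_mul_slice (hR : Q.R = ∑ i, a i ⊗ₜ[k] b i) {g x : A}
    (hx : IsSkewPrimitive k A 1 g x) (χ : A →ₐ[k] k) (hχ : χ x = 0) :
    x * slice a b χ.toLinearMap = χ g • (slice a b χ.toLinearMap * x) := by
  have h := congrArg ((TensorProduct.lid k A).toLinearMap ∘ₗ
    TensorProduct.map χ.toLinearMap LinearMap.id) (Q.intertwine x)
  rw [hR, hx] at h
  simp only [map_add, TensorProduct.comm_tmul, add_mul, mul_add, Finset.mul_sum, Finset.sum_mul,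
    Algebra.TensorProduct.tmul_mul_tmul, map_sum, LinearMap.comp_apply, TensorProduct.map_tmul,
    AlgHom.toLinearMap_apply, map_mul, hχ, LinearEquiv.coe_coe, TensorProduct.lid_tmul, one_mul,
    zero_mul, mul_zero, zero_smul, Finset.sum_const_zero, add_zero, zero_add, mul_one,
    LinearMap.id_coe, id_eq] at h
  simpa [slice_apply, Finset.mul_sum, Finset.sum_mul, Finset.smul_sum, smul_smul, mul_comm]
    using h

end RMatrix

theorem nontrivial_of_bialgebra (A : Type*) [Ring A] [Bialgebra k A] : Nontrivial A := by
  refine ⟨0, 1, fun h => ?_⟩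
  have := congrArg (Coalgebra.counit (R := k)) h
  simp at this

namespace HDPresentation

variable {k} {G : Type w} [CommGroup G] {F : G → G → kˣ} {n : G → ℕ}
  {H : Type v} [Ring H] [HopfAlgebra k H] (D : HDPresentation k G F n H)

/-- The representation of `H(D)` by upper triangular `2 × 2` matrices attached to a linear form
on `V_h`. -/
theorem exists_upperTriangular (hF : IsNondegSkewForm k G F) {h : G} (hh : F h h = -1)
    (ω : Module.Dual k (Fin (n h) → k)) :
    ∃ θ : H →ₐ[k] Matrix (Fin 2) (Fin 2) H, (∀ a, θ (D.ι a) 0 1 = 0) ∧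
      ∀ v, θ (D.ψ h v) 0 1 = algebraMap k H (ω v) := by
  classical
  let j : G →* Matrix (Fin 2) (Fin 2) H :=
    { toFun := fun a => !![1, 0; 0, algebraMap k H (F a h)]
      map_one' := by simp [hF.one_left, Matrix.one_fin_two]
      map_mul' := fun a b => by
        simp [hF.mul_left]
        rw [Algebra.smul_def] }
  let E : k →ₗ[k] Matrix (Fin 2) (Fin 2) H :=
    { toFun := fun c => !![0, algebraMap k H c; 0, 0]
      map_add' := fun c d => by simp
      map_smul' := fun c d => by simp [Matrix.smul_of, Algebra.algebraMap_eq_smul_one, smul_smul] }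
  let ζ : ∀ g : G, (Fin (n g) → k) →ₗ[k] Matrix (Fin 2) (Fin 2) H :=
    fun g => E ∘ₗ (Pi.single h ω : ∀ g : G, Module.Dual k (Fin (n g) → k)) g
  obtain ⟨θ, ⟨hθι, hθψ⟩, -⟩ := D.free _ j ζ
    (fun g hg => by
      have : g ≠ h := fun e => hg (e ▸ hh)
      simp [ζ, Pi.single_eq_of_ne this])
    (fun g g' _ _ v v' => by simp [ζ, E])
    (fun g a _ v => by
      by_cases hgh : g = h
      · subst hgh
        ext s t
        fin_cases s <;> fin_cases t <;>
          simp [ζ, E, j, Algebra.algebraMap_eq_smul_one, smul_smul, mul_comm]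
      · simp [ζ, Pi.single_eq_of_ne hgh])
  exact ⟨θ, fun a => by simp [hθι, j], fun v => by simp [hθψ, ζ, E]⟩

theorem eq_zero_of_ψ_eq_smul_sub_one (hF : IsNondegSkewForm k G F) {h : G} (hh : F h h = -1)
    {v : Fin (n h) → k} {c : k} {a : G} (hv : D.ψ h v = c • (D.ι a - 1)) : v = 0 := by
  have := nontrivial_of_bialgebra k H
  refine (Module.forall_dual_apply_eq_zero_iff k v).1 fun ω => ?_
  obtain ⟨θ, hι, hψ⟩ := D.exists_upperTriangular hF hh ω
  have h1 := hψ v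
  rw [hv, map_smul, map_sub, map_one, Matrix.smul_apply, Matrix.sub_apply, hι] at h1
  simpa using h1.symm

theorem character_ψ [CharZero k] (χ : H →ₐ[k] k) (g : G) (v : Fin (n g) → k) :
    χ (D.ψ g v) = 0 := by
  by_cases hg : F g g = -1
  · have h := congrArg χ (D.comm_ψψ g g hg hg v v)
    rw [hg] at h
    simp only [map_smul, map_mul, Units.val_neg, Units.val_one, smul_eq_mul, neg_mul,
      one_mul] at h
    exact mul_self_eq_zero.1 (self_eq_neg.1 h)
  · simp [D.ψ_eq_zero g hg]

theorem character_ext [CharZero k] {χ χ' : H →ₐ[k] k} (h : ∀ a, χ (D.ι a) = χ' (D.ι a)) :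
    χ = χ' := by
  refine AlgHom.ext_of_adjoin_eq_top D.generates ?_
  rintro x (⟨a, rfl⟩ | hx)
  · exact h a
  · obtain ⟨g, v, rfl⟩ := Set.mem_iUnion.1 hx
    rw [D.character_ψ, D.character_ψ]

theorem skewDerivation_eq_zero {p : Module.Dual k H} {χ ε : H →ₐ[k] k}
    (hp : ∀ y z, p (y * z) = p y * χ z + ε y * p z) (hι : ∀ a, p (D.ι a) = 0)
    (hψ : ∀ g v, p (D.ψ g v) = 0) : p = 0 := by
  have h1 : p 1 = 0 := by simpa using hι 1
  ext x
  have hx : x ∈ Algebra.adjoin k (Set.range ⇑D.ι ∪ ⋃ g : G, Set.range ⇑(D.ψ g)) :=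
    D.generates ▸ Algebra.mem_top
  induction hx using Algebra.adjoin_induction with
  | mem x hx =>
    rcases hx with ⟨a, rfl⟩ | hx
    · exact hι a
    · obtain ⟨g, v, rfl⟩ := Set.mem_iUnion.1 hx
      exact hψ g v
  | algebraMap r => simp [Algebra.algebraMap_eq_smul_one, h1]
  | add x y _ _ hx hy => simp_all
  | mul x y _ _ hx hy => simp_all

theorem ι_mul_ψ_ne_zero (hF : IsNondegSkewForm k G F) {h : G} (hh : F h h = -1)
    {v : Fin (n h) → k} (hv : v ≠ 0) (a : G) : D.ι a * D.ψ h v ≠ 0 := by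
  intro h0
  have h1 : D.ψ h v = 0 := by
    rw [← one_mul (D.ψ h v), ← map_one D.ι, ← inv_mul_cancel a, map_mul, mul_assoc, h0, mul_zero]
  exact hv (D.eq_zero_of_ψ_eq_smul_sub_one hF hh (c := 0) (a := 1) (by rw [h1, zero_smul]))

theorem ι_injective (hF : IsNondegSkewForm k G F) : Function.Injective D.ι := by
  have := nontrivial_of_bialgebra k H
  intro a b hab
  have key : ∀ h, F a h = F b h := by
    intro h
    let j : G →* H :=
      { toFun := fun a => algebraMap k H (F a h)
        map_one' := by simp [hF.one_left]
        map_mul' := fun a b => by simp [hF.mul_left] }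
    obtain ⟨θ, ⟨hθ, -⟩, -⟩ := D.free H j (fun _ => 0) (by simp) (by simp) (by simp)
    have h1 : algebraMap k H (F a h) = algebraMap k H (F b h) :=
      (hθ a).symm.trans ((congrArg θ hab).trans (hθ b))
    exact Units.ext ((algebraMap k H).injective h1)
  let χ : G →* kˣ :=
    { toFun := F b
      map_one' := hF.one_right b
      map_mul' := hF.mul_right b }
  exact (hF.nondeg χ).unique key fun _ => rfl

end HDPresentation

theorem HDPresentation.dim_le_dim_inv {k : Type*} [Field k] [CharZero k]
    {G : Type w} [CommGroup G] {F : G → G → kˣ} {n : G → ℕ}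
    {H : Type v} [Ring H] [HopfAlgebra k H] (D : HDPresentation k G F n H)
    (hF : IsNondegSkewForm k G F) (Q : QuasiTriangular k H)
    (hT : Q.IsTriangular) (hM : Q.IsMinimal) {g : G} (hg : F g g = -1) (hn : n g ≠ 0) :
    n g ≤ n g⁻¹ := by
  obtain ⟨m, a, b, hR⟩ := exists_fintype_sum_tmul Q.R
  have hbij := slice_bijective Q a b hT hM hR
  choose χ hχ using fun x : G =>
    exists_character_of_isGrouplike Q a b hT hM hR (D.ι_grouplike x)
  have hχF : ∀ (x h : G), F h h = -1 → n h ≠ 0 → χ x (D.ι h) = F x h := by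
    intro x h hh hnh
    have : NeZero (n h) := ⟨hnh⟩
    have h1 := skewPrimitive_mul_slice Q a b hR (D.ψ_skewPrimitive h 1) (χ x)
      (D.character_ψ _ _ _)
    rw [hχ, D.comm_ψι h x hh] at h1
    exact (smul_left_injective k (D.ι_mul_ψ_ne_zero hF hh one_ne_zero x) h1).symm
  have hχskew : ∀ x y : G, χ y (D.ι x) * χ x (D.ι y) = 1 := by
    intro x y
    have := character_slice_mul Q a b hT hR (χ x) (χ y)
    rwa [hχ, hχ] at this
  have hχnondeg : ∀ y : G, (∀ x, χ x (D.ι y) = 1) → y = 1 := by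
    intro y hy
    have h1 : χ y = χ 1 := D.character_ext fun x => by
      have e1 := hχskew y x
      have e2 := hχskew 1 x
      rw [hy, one_mul] at e1
      rw [map_one, map_one, one_mul] at e2
      rw [e1, e2]
    exact D.ι_injective hF (by rw [← hχ, ← hχ, h1])
  let f := LinearEquiv.ofBijective (slice a b) hbij
  let Φ : (Fin (n g) → k) →ₗ[k] Module.Dual k (Fin (n g⁻¹) → k) :=
    LinearMap.lcomp k k (D.ψ g⁻¹) ∘ₗ f.symm.toLinearMap ∘ₗ D.ψ g
  suffices hΦ : Function.Injective Φ by
    have := LinearMap.finrank_le_finrank_of_injective hΦ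
    rwa [Subspace.dual_finrank_eq, Module.finrank_fin_fun, Module.finrank_fin_fun] at this
  refine (injective_iff_map_eq_zero _).2 fun v hv => ?_
  set p : Module.Dual k H := f.symm (D.ψ g v) with hp
  have hfp : slice a b p = D.ψ g v := f.apply_symm_apply _
  have hpmul : ∀ y z, p (y * z) =
      p y * χ g z + Bialgebra.counitAlgHom k H y * p z :=
    dual_mul_of_isSkewPrimitive Q a b hT hM hR (by
      rw [hfp, hχ]; exact D.ψ_skewPrimitive g v)
  have hε : ∀ x, Bialgebra.counitAlgHom k H (D.ι x) = 1 := fun x => (D.ι_grouplike x).1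
  have hχg : χ g (D.ι g) = -1 := by rw [hχF g g hg hn, hg]; simp
  have hpι : ∀ x, p (D.ι x) = -(p (D.ι g) / 2) * (χ g (D.ι x) - 1) := by
    intro x
    have e1 := hpmul (D.ι x) (D.ι g)
    have e2 := hpmul (D.ι g) (D.ι x)
    rw [← map_mul, mul_comm, map_mul, e2, hε, hε, hχg] at e1
    linear_combination (1 / 2) * e1
  have hpψ : ∀ h (w : Fin (n h) → k), p (D.ψ h w) = 0 := by
    intro h w
    by_contra hne
    have hw : w ≠ 0 := by rintro rfl; simp at hne
    have hnh : n h ≠ 0 := by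
      intro h0
      exact hw (funext fun i => (Fin.cast h0 i).elim0)
    have hh : F h h = -1 := by
      by_contra hh
      exact hne (by simp [D.ψ_eq_zero h hh])
    have hhg : h * g = 1 := by
      refine hχnondeg _ fun x => ?_
      have e := congrArg p (D.comm_ψι h x hh w)
      rw [hpmul, map_smul, hpmul, D.character_ψ, D.character_ψ, hε, mul_zero, zero_mul, zero_add,
        one_mul, add_zero, smul_eq_mul, mul_comm] at e
      rw [map_mul, map_mul, hχF x h hh hnh, ← mul_right_cancel₀ hne e, mul_comm]
      exact hχskew g x
    obtain rfl := eq_inv_of_mul_eq_one_left hhg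
    exact hne (LinearMap.congr_fun hv w)
  have hp0 : p + (p (D.ι g) / 2) • ((χ g).toLinearMap - (Bialgebra.counitAlgHom k H).toLinearMap)
      = 0 := by
    refine D.skewDerivation_eq_zero (χ := χ g) (ε := Bialgebra.counitAlgHom k H) ?_ ?_ ?_
    · intro y z
      simp only [LinearMap.add_apply, LinearMap.smul_apply, LinearMap.sub_apply,
        AlgHom.toLinearMap_apply, hpmul, map_mul, smul_eq_mul]
      ring
    · intro x
      simp only [LinearMap.add_apply, LinearMap.smul_apply, LinearMap.sub_apply,
        AlgHom.toLinearMap_apply, smul_eq_mul, hε]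
      rw [hpι x]
      ring
    · intro h w
      simp only [LinearMap.add_apply, LinearMap.smul_apply, LinearMap.sub_apply,
        AlgHom.toLinearMap_apply, hpψ, D.character_ψ]
      simp
  have hψ := congrArg (slice a b) hp0
  have hc : slice a b (Bialgebra.counitAlgHom k H).toLinearMap = 1 := slice_counit Q a b hR
  rw [map_add, map_smul, map_sub, hfp, hχ, hc, map_zero] at hψ
  exact D.eq_zero_of_ψ_eq_smul_sub_one hF hg (c := -(p (D.ι g) / 2)) (a := g)
    (by rw [neg_smul]; exact eq_neg_of_add_eq_zero_left hψ)

/-- Let `D = (G,F,n)` be a datum over an algebraically closed field `k`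
of characteristic `0`. If `n_{g⁻¹} ≠ n_g` for some `g ∈ I_F' = {g ∈ I_F | n_g ≠ 0}`,
then `H(D)` does not admit a minimal triangular structure. -/
theorem HD_no_minimal_triangular_structure
    (k : Type u) [Field k] [IsAlgClosed k] [CharZero k]
    (G : Type w) [CommGroup G] [Fintype G] (F : G → G → kˣ) (n : G → ℕ)
    (hF : IsNondegSkewForm k G F)
    (H : Type v) [Ring H] [HopfAlgebra k H] (D : HDPresentation k G F n H)
    (g : G) (hg : F g g = -1) (hg' : n g ≠ 0) (hne : n g⁻¹ ≠ n g) :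
    ¬ ∃ Q : QuasiTriangular k H, Q.IsTriangular ∧ Q.IsMinimal := by
  rintro ⟨Q, hT, hM⟩
  have h₁ := D.dim_le_dim_inv hF Q hT hM hg hg'
  have hgi : F g⁻¹ g⁻¹ = -1 := by
    have e₁ : F g⁻¹ g * F g g = 1 := by rw [← hF.mul_left, inv_mul_cancel, hF.one_left]
    have e₂ : F g⁻¹ g⁻¹ * F g⁻¹ g = 1 := by rw [← hF.mul_right, inv_mul_cancel, hF.one_right]
    rw [hg] at e₁
    rw [eq_inv_of_mul_eq_one_left e₂, eq_inv_of_mul_eq_one_left e₁, inv_inv]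
  have h₂ := D.dim_le_dim_inv hF Q hT hM hgi (by omega)
  rw [inv_inv] at h₂
  exact hne (le_antisymm h₂ h₁)

end Paper
end
end
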